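/- Let m > 0 and β > 0. There exists a C¹ solution (h, f, g) : ℝ → ℝ³ of the rescaled BPS system m h' = −β(f² − 1) − β g², f' = −m f h, g' = −m(h + 1)g, satisfying the boundary conditions (h, f, g)(x) → (−1, 0, 1) as x → −∞ and (h, f, g)(x) → (0, 1, 0) as x → +∞; moreover this solution is unique up to translations of the independent variable x. -/

import Mathlib

open Filter

open scoped BoundedContinuousFunction

lemma exists_hasDerivAt_mul_sub {k : ℝ} (hk : 0 < k) (u : ℝ →ᵇ ℝ) :
    ∃ w : ℝ →ᵇ ℝ, ∀ x, HasDerivAt w (k * w x - u x) x := by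
  have hcont : Continuous fun y => Real.exp (-k * y) * u y := by fun_prop
  have hbound : ∀ y, ‖Real.exp (-k * y) * u y‖ ≤ ‖u‖ * Real.exp (-k * y) := fun y => by
    rw [norm_mul, Real.norm_of_nonneg (Real.exp_pos _).le, mul_comm]
    gcongr
    exact u.norm_coe_le_norm y
  have hexp : ∀ x, MeasureTheory.IntegrableOn (fun y => ‖u‖ * Real.exp (-k * y)) (Set.Ioi x) :=
    fun x => (exp_neg_integrableOn_Ioi x hk).const_mul _
  have hint : ∀ x, MeasureTheory.IntegrableOn (fun y => Real.exp (-k * y) * u y) (Set.Ioi x) :=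
    fun x => (hexp x).mono' hcont.aestronglyMeasurable (.of_forall hbound)
  set J : ℝ → ℝ := fun x => ∫ y in Set.Ioi x, Real.exp (-k * y) * u y with hJ
  have hJeq : J = fun x => J 0 - ∫ y in (0 : ℝ)..x, Real.exp (-k * y) * u y := by
    funext x
    simp only [hJ]
    rw [← intervalIntegral.integral_interval_add_Ioi (hint 0) (hint x)]
    ring
  have hJ' : ∀ x, HasDerivAt J (-(Real.exp (-k * x) * u x)) x := fun x => by
    rw [hJeq]
    exact (intervalIntegral.integral_hasDerivAt_right (hcont.intervalIntegrable _ _)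
      hcont.aestronglyMeasurable.stronglyMeasurableAtFilter hcont.continuousAt).const_sub _
  have hJbound : ∀ x, ‖J x‖ ≤ ‖u‖ * (Real.exp (-k * x) / k) := fun x => by
    refine (MeasureTheory.norm_integral_le_of_norm_le (hexp x) (.of_forall hbound)).trans ?_
    rw [MeasureTheory.integral_const_mul, integral_exp_mul_Ioi (by linarith)]
    rw [neg_div_neg_eq]
  have hinv : ∀ x, Real.exp (k * x) * Real.exp (-k * x) = 1 := fun x => by
    rw [← Real.exp_add]; simp
  have hw : ∀ x, HasDerivAt (fun x => Real.exp (k * x) * J x)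
      (k * (Real.exp (k * x) * J x) - u x) x := fun x => by
    have h := (((hasDerivAt_id x).const_mul k).exp).mul (hJ' x)
    refine h.congr_deriv ?_
    simp only [id]
    linear_combination (-u x) * hinv x
  refine ⟨.ofNormedAddCommGroup _ (continuous_iff_continuousAt.2 fun x => (hw x).continuousAt)
    (‖u‖ / k) fun x => ?_, hw⟩
  rw [norm_mul, Real.norm_of_nonneg (Real.exp_pos _).le]
  calc _ ≤ Real.exp (k * x) * (‖u‖ * (Real.exp (-k * x) / k)) := by gcongr; exact hJbound x
    _ = (Real.exp (k * x) * Real.exp (-k * x)) * (‖u‖ / k) := by ring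
    _ = _ := by rw [hinv, one_mul]

lemma nonneg_of_hasDerivAt_le_mul {k : ℝ} (hk : 0 < k) (w : ℝ →ᵇ ℝ) {w' : ℝ → ℝ}
    (hw : ∀ x, HasDerivAt w (w' x) x) (hle : ∀ x, w' x ≤ k * w x) (x : ℝ) : 0 ≤ w x := by
  have hanti : Antitone fun x => Real.exp (-k * x) * w x := by
    refine antitone_of_hasDerivAt_nonpos
      (fun x => (((hasDerivAt_id x).const_mul (-k)).exp).mul (hw x)) fun x => ?_
    simp only [id, Pi.zero_apply]
    nlinarith [mul_nonneg (Real.exp_pos (-k * x)).le (sub_nonneg.2 (hle x))]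
  have hlim : Tendsto (fun x => Real.exp (-k * x) * w x) atTop (nhds 0) := by
    refine squeeze_zero_norm (a := fun x => Real.exp (-k * x) * ‖w‖) (fun x => ?_) ?_
    · rw [norm_mul, Real.norm_of_nonneg (Real.exp_pos _).le]
      gcongr
      exact w.norm_coe_le_norm x
    · have : Tendsto (fun x => Real.exp (-k * x)) atTop (nhds 0) :=
        Real.tendsto_exp_atBot.comp (tendsto_id.const_mul_atTop_of_neg (by linarith))
      simpa using this.mul_const ‖w‖
  exact nonneg_of_mul_nonneg_right (hanti.le_of_tendsto hlim x) (Real.exp_pos _)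

/-- A bounded continuous function precomposed with the reflection `x ↦ -x`. -/
noncomputable def reflect (u : ℝ →ᵇ ℝ) : ℝ →ᵇ ℝ := u.compContinuous ⟨fun x => -x, continuous_neg⟩

@[simp] lemma reflect_apply (u : ℝ →ᵇ ℝ) (x : ℝ) : reflect u x = u (-x) := rfl

lemma hasDerivAt_reflect {u : ℝ →ᵇ ℝ} {u' : ℝ → ℝ} (hu : ∀ x, HasDerivAt u (u' x) x) (x : ℝ) :
    HasDerivAt (reflect u) (-u' (-x)) x := by
  have h := (hu (-x)).comp x (hasDerivAt_neg x)
  rw [mul_neg_one] at h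
  exact h

/-- The equation `k² v - v'' = u` has a bounded solution with bounded derivative. -/
lemma exists_sq_mul_sub_deriv_deriv {k : ℝ} (hk : 0 < k) (u : ℝ →ᵇ ℝ) :
    ∃ v p : ℝ →ᵇ ℝ, (∀ x, HasDerivAt v (p x) x) ∧
      ∀ x, HasDerivAt p (k ^ 2 * v x - u x) x := by
  obtain ⟨w, hw⟩ := exists_hasDerivAt_mul_sub hk (reflect u)
  have ha : ∀ x, HasDerivAt (reflect w) (u x - k * reflect w x) x := fun x =>
    (hasDerivAt_reflect hw x).congr_deriv (by simp)
  obtain ⟨v, hv⟩ := exists_hasDerivAt_mul_sub hk (reflect w)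
  exact ⟨v, k • v - reflect w, hv, fun x =>
    (((hv x).const_mul k).sub (ha x)).congr_deriv (by ring)⟩

/-- Comparison principle for `k² - d²/dx²` on the line. -/
lemma nonneg_of_deriv_deriv_le {k : ℝ} (hk : 0 < k) (v p : ℝ →ᵇ ℝ) {q : ℝ → ℝ}
    (hv : ∀ x, HasDerivAt v (p x) x) (hp : ∀ x, HasDerivAt p (q x) x)
    (hle : ∀ x, q x ≤ k ^ 2 * v x) (x : ℝ) : 0 ≤ v x := by
  have ha : ∀ x, HasDerivAt (k • v - p) (k * p x - q x) x := fun x =>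
    ((hv x).const_mul k).sub (hp x)
  have hnn : ∀ x, 0 ≤ (k • v - p) x := fun x => by
    have := nonneg_of_hasDerivAt_le_mul hk (reflect (k • v - p)) (hasDerivAt_reflect ha)
      (fun x => by simp; nlinarith [hle (-x)]) (-x)
    simpa using this
  refine nonneg_of_hasDerivAt_le_mul hk v hv (fun x => ?_) x
  have := hnn x
  simp at this
  linarith

/-- Sub- and supersolutions `vl`, `vu` of `v'' = k² (v - φ v) + s`, with `φ` a monotone
contraction, enclose a solution. -/
lemma exists_solution_between {k : ℝ} (hk : 0 < k) {L : NNReal} (hL : L < 1) {φ : ℝ → ℝ}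
    (hφ : Monotone φ) (hφL : LipschitzWith L φ) (s vl pl vu pu : ℝ →ᵇ ℝ) {ql qu : ℝ → ℝ}
    (hvl : ∀ x, HasDerivAt vl (pl x) x) (hpl : ∀ x, HasDerivAt pl (ql x) x)
    (hql : ∀ x, k ^ 2 * (vl x - φ (vl x)) + s x ≤ ql x)
    (hvu : ∀ x, HasDerivAt vu (pu x) x) (hpu : ∀ x, HasDerivAt pu (qu x) x)
    (hqu : ∀ x, qu x ≤ k ^ 2 * (vu x - φ (vu x)) + s x) :
    ∃ v p : ℝ → ℝ, (∀ x, HasDerivAt v (p x) x) ∧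
      (∀ x, HasDerivAt p (k ^ 2 * (v x - φ (v x)) + s x) x) ∧
      ∀ x, vl x ≤ v x ∧ v x ≤ vu x := by
  have hk2 : 0 < k ^ 2 := by positivity
  choose T P hT hP using fun v : ℝ →ᵇ ℝ =>
    exists_sq_mul_sub_deriv_deriv hk (k ^ 2 • v.comp φ hφL - s)
  have hP' : ∀ v x, HasDerivAt (P v) (k ^ 2 * (T v x - φ (v x)) + s x) x := fun v x =>
    (hP v x).congr_deriv (by simp; ring)
  have hmono : Monotone T := fun a b hab x => by
    have := nonneg_of_deriv_deriv_le hk (T b - T a) (P b - P a)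
      (fun x => (hT b x).sub (hT a x)) (fun x => (hP' b x).sub (hP' a x))
      (fun x => by
        have hx : φ (a x) ≤ φ (b x) := hφ (hab x)
        have := mul_le_mul_of_nonneg_left hx hk2.le
        simp only [BoundedContinuousFunction.coe_sub, Pi.sub_apply]
        linarith) x
    simpa using this
  have hle : ∀ a b : ℝ →ᵇ ℝ, ∀ x, T a x - T b x ≤ L * dist a b := fun a b x => by
    have := nonneg_of_deriv_deriv_le hk (.const ℝ (L * dist a b) - (T a - T b)) (0 - (P a - P b))
      (fun x => (hasDerivAt_const x _).sub ((hT a x).sub (hT b x)))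
      (fun x => (hasDerivAt_const x _).sub ((hP' a x).sub (hP' b x)))
      (fun x => by
        have h1 : φ (a x) - φ (b x) ≤ L * dist a b := by
          refine (le_abs_self _).trans ((hφL.dist_le_mul (a x) (b x)).trans ?_)
          gcongr
          exact BoundedContinuousFunction.dist_coe_le_dist x
        have := mul_le_mul_of_nonneg_left h1 hk2.le
        simp only [BoundedContinuousFunction.coe_sub, Pi.sub_apply,
          BoundedContinuousFunction.const_apply]
        linarith) x
    simpa using this
  have hcontr : ContractingWith L T := ⟨hL, .of_dist_le_mul fun a b => by
    refine (BoundedContinuousFunction.dist_le (by positivity)).2 fun x => ?_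
    refine abs_sub_le_iff.2 ⟨hle a b x, ?_⟩
    rw [dist_comm]
    exact hle b a x⟩
  have hTvl : vl ≤ T vl := fun x => by
    have := nonneg_of_deriv_deriv_le hk (T vl - vl) (P vl - pl)
      (fun x => (hT vl x).sub (hvl x)) (fun x => (hP' vl x).sub (hpl x))
      (fun x => by
        simp only [BoundedContinuousFunction.coe_sub, Pi.sub_apply]
        linarith [hql x]) x
    simpa using this
  have hTvu : T vu ≤ vu := fun x => by
    have := nonneg_of_deriv_deriv_le hk (vu - T vu) (pu - P vu)
      (fun x => (hvu x).sub (hT vu x)) (fun x => (hpu x).sub (hP' vu x))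
      (fun x => by
        simp only [BoundedContinuousFunction.coe_sub, Pi.sub_apply]
        linarith [hqu x]) x
    simpa using this
  set v := ContractingWith.fixedPoint T hcontr
  have hfix : T v = v := hcontr.fixedPoint_isFixedPt
  have heval : ∀ u x, Tendsto (fun n => (T^[n] u) x) atTop (nhds (v x)) := fun u x =>
    (BoundedContinuousFunction.tendsto_iff_tendstoUniformly.1
      (hcontr.tendsto_iterate_fixedPoint u)).tendsto_at x
  refine ⟨v, P v, fun x => ?_, fun x => ?_, fun x => ⟨?_, ?_⟩⟩
  · simpa only [hfix] using hT v x
  · simpa only [hfix] using hP' v x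
  · exact ge_of_tendsto' (heval vl x) fun n =>
      (hmono.monotone_iterate_of_le_map hTvl (Nat.zero_le n)) x
  · exact le_of_tendsto' (heval vu x) fun n =>
      (hmono.antitone_iterate_of_map_le hTvu (Nat.zero_le n)) x

/-- The function `x ↦ log (2 cosh x)`, a smooth approximation of `|x|`. -/
noncomputable def logTwoCosh (x : ℝ) : ℝ := Real.log (2 * Real.cosh x)

lemma exp_logTwoCosh (x : ℝ) : Real.exp (logTwoCosh x) = Real.exp x + Real.exp (-x) := by
  rw [logTwoCosh, Real.exp_log (by have := Real.cosh_pos x; positivity), Real.cosh_eq]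
  ring

lemma logTwoCosh_neg (x : ℝ) : logTwoCosh (-x) = logTwoCosh x := by
  simp [logTwoCosh]

lemma abs_le_logTwoCosh (x : ℝ) : |x| ≤ logTwoCosh x := by
  rw [← Real.exp_le_exp, exp_logTwoCosh]
  rcases abs_cases x with ⟨h, -⟩ | ⟨h, -⟩ <;> rw [h] <;>
    linarith [Real.exp_pos x, Real.exp_pos (-x)]

lemma logTwoCosh_le (x : ℝ) : logTwoCosh x ≤ |x| + Real.log 2 := by
  rw [← Real.exp_le_exp, exp_logTwoCosh, Real.exp_add, Real.exp_log two_pos]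
  linarith [Real.exp_le_exp.2 (le_abs_self x), Real.exp_le_exp.2 (neg_le_abs x)]

lemma hasDerivAt_logTwoCosh (x : ℝ) : HasDerivAt logTwoCosh (Real.tanh x) x := by
  have hc := Real.cosh_pos x
  refine (((Real.hasDerivAt_cosh x).const_mul 2).log (by positivity)).congr_deriv ?_
  rw [Real.tanh_eq_sinh_div_cosh]
  field_simp

lemma hasDerivAt_tanh (x : ℝ) : HasDerivAt Real.tanh (1 / Real.cosh x ^ 2) x := by
  have hc := Real.cosh_pos x
  have h := (Real.hasDerivAt_sinh x).div (Real.hasDerivAt_cosh x) hc.ne'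
  have he : Real.tanh = Real.sinh / Real.cosh := funext Real.tanh_eq_sinh_div_cosh
  rw [he]
  refine h.congr_deriv ?_
  rw [← Real.cosh_sq_sub_sinh_sq x]
  ring

lemma tendsto_logTwoCosh_sub_self : Tendsto (fun x => logTwoCosh x - x) atTop (nhds 0) := by
  have heq : (fun x => logTwoCosh x - x) = fun x => Real.log (1 + Real.exp (-2 * x)) := by
    funext x
    rw [← Real.exp_eq_exp, Real.exp_log (by positivity), Real.exp_sub, exp_logTwoCosh,
      add_div, ← Real.exp_sub, ← Real.exp_sub]
    simp
    ring
  have hexp : Tendsto (fun x : ℝ => Real.exp (-2 * x)) atTop (nhds 0) :=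
    Real.tendsto_exp_atBot.comp (tendsto_id.const_mul_atTop_of_neg (by norm_num))
  rw [heq]
  simpa using (hexp.const_add 1).log (by norm_num)

lemma tendsto_inv_cosh : Tendsto (fun x => 1 / Real.cosh x) atTop (nhds 0) := by
  refine squeeze_zero (fun x => by have := Real.cosh_pos x; positivity) (fun x => ?_)
    (by simpa using Real.tendsto_exp_neg_atTop_nhds_zero.const_mul 2)
  rw [div_le_iff₀ (Real.cosh_pos x), Real.cosh_eq]
  have : Real.exp (-x) * Real.exp x = 1 := by rw [← Real.exp_add]; simp
  nlinarith [Real.exp_pos (-x)]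

lemma tendsto_tanh_atTop : Tendsto Real.tanh atTop (nhds 1) := by
  have h := Real.tendsto_exp_neg_atTop_nhds_zero.mul tendsto_inv_cosh
  have heq : Real.tanh = fun x => 1 - Real.exp (-x) * (1 / Real.cosh x) := by
    funext x
    have hc := Real.cosh_pos x
    rw [Real.tanh_eq_sinh_div_cosh, ← Real.cosh_sub_sinh]
    field_simp
    ring
  rw [heq]
  simpa using h.const_sub 1

lemma tendsto_tanh_atBot : Tendsto Real.tanh atBot (nhds (-1)) := by
  simpa [Function.comp_def] using (tendsto_tanh_atTop.comp tendsto_neg_atBot_atTop).neg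

/-- The subsolution `logTwoCosh (n t) - n logTwoCosh t`. -/
noncomputable def barrier (n : ℕ) (t : ℝ) : ℝ := logTwoCosh (n * t) - n * logTwoCosh t

lemma barrier_neg (n : ℕ) (t : ℝ) : barrier n (-t) = barrier n t := by
  simp only [barrier, mul_neg, logTwoCosh_neg]

lemma exp_barrier_le (q : ℕ) (t : ℝ) :
    Real.exp (barrier (q + 2) t) ≤ 1 - 1 / (2 * Real.cosh t ^ 2) := by
  have hZ := Real.exp_pos t
  have hW := Real.exp_pos (-t)
  have hZW : Real.exp t * Real.exp (-t) = 1 := by rw [← Real.exp_add]; simp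
  have hn : -(((q + 2 : ℕ) : ℝ) * t) = ((q + 2 : ℕ) : ℝ) * -t := by ring
  rw [barrier, Real.exp_sub, exp_logTwoCosh, hn, Real.exp_nat_mul, Real.exp_nat_mul,
    Real.exp_nat_mul, exp_logTwoCosh, Real.cosh_eq]
  set Z := Real.exp t
  set W := Real.exp (-t)
  have hrhs : 1 - 1 / (2 * ((Z + W) / 2) ^ 2) = (Z ^ 2 + W ^ 2) / (Z + W) ^ 2 := by
    field_simp
    linear_combination 2 * hZW
  rw [hrhs, div_le_div_iff₀ (by positivity) (by positivity)]
  have hZq : Z ^ q ≤ (Z + W) ^ q := by gcongr; linarith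
  have hWq : W ^ q ≤ (Z + W) ^ q := by gcongr; linarith
  have key : Z ^ (q + 2) + W ^ (q + 2) ≤ (Z ^ 2 + W ^ 2) * (Z + W) ^ q := by
    have h1 := mul_le_mul_of_nonneg_left hZq (sq_nonneg Z)
    have h2 := mul_le_mul_of_nonneg_left hWq (sq_nonneg W)
    linarith [pow_add Z q 2, pow_add W q 2]
  calc _ ≤ (Z ^ 2 + W ^ 2) * (Z + W) ^ q * (Z + W) ^ 2 := by gcongr
    _ = _ := by ring

lemma barrier_nonpos (q : ℕ) (t : ℝ) : barrier (q + 2) t ≤ 0 := by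
  rw [← Real.exp_le_one_iff]
  have : 0 ≤ 1 / (2 * Real.cosh t ^ 2) := by positivity
  linarith [exp_barrier_le q t]

lemma le_barrier (n : ℕ) (t : ℝ) : -(n * Real.log 2) ≤ barrier n t := by
  have h1 := abs_le_logTwoCosh (n * t)
  rw [abs_mul, Nat.abs_cast] at h1
  have h2 := mul_le_mul_of_nonneg_left (logTwoCosh_le t) n.cast_nonneg
  rw [barrier]
  linarith

lemma tendsto_barrier_atTop {n : ℕ} (hn : 0 < n) : Tendsto (barrier n) atTop (nhds 0) := by
  have h1 : Tendsto (fun t : ℝ => (n : ℝ) * t) atTop atTop :=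
    tendsto_id.const_mul_atTop (by positivity)
  have h := (tendsto_logTwoCosh_sub_self.comp h1).sub
    (tendsto_logTwoCosh_sub_self.const_mul (n : ℝ))
  simp only [mul_zero, sub_zero] at h
  refine h.congr fun t => ?_
  simp only [Function.comp_apply, barrier]
  ring

lemma tendsto_barrier_atBot {n : ℕ} (hn : 0 < n) : Tendsto (barrier n) atBot (nhds 0) :=
  ((tendsto_barrier_atTop hn).comp tendsto_neg_atBot_atTop).congr fun t => barrier_neg n t

lemma hasDerivAt_barrier (n : ℕ) (t : ℝ) :
    HasDerivAt (barrier n) (n * (Real.tanh (n * t) - Real.tanh t)) t := by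
  have h := ((hasDerivAt_logTwoCosh (n * t)).comp t ((hasDerivAt_id t).const_mul (n : ℝ))).sub
    ((hasDerivAt_logTwoCosh t).const_mul (n : ℝ))
  exact h.congr_deriv (by ring)

/-- The function `v ↦ v - (exp v - 1)`, frozen outside `[-M, 0]`. -/
noncomputable def truncatedGap (M v : ℝ) : ℝ :=
  max (-M) (min v 0) - (Real.exp (max (-M) (min v 0)) - 1)

lemma truncatedGap_of_mem {M v : ℝ} (h1 : -M ≤ v) (h2 : v ≤ 0) :
    truncatedGap M v = v - (Real.exp v - 1) := by
  rw [truncatedGap, min_eq_left h2, max_eq_right h1]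

lemma monotone_truncatedGap {M : ℝ} (hM : 0 ≤ M) : Monotone (truncatedGap M) := fun b a hab => by
  simp only [truncatedGap]
  have hle : max (-M) (min b 0) ≤ max (-M) (min a 0) := by gcongr
  have ha : max (-M) (min a 0) ≤ 0 := max_le (by linarith) (min_le_right _ _)
  set x := max (-M) (min b 0)
  set y := max (-M) (min a 0)
  have h1 : Real.exp x = Real.exp y * Real.exp (x - y) := by rw [← Real.exp_add]; ring_nf
  nlinarith [Real.add_one_le_exp (x - y), Real.exp_pos y, Real.exp_le_one_iff.2 ha]

lemma lipschitzWith_truncatedGap {M : ℝ} (hM : 0 ≤ M) :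
    LipschitzWith (1 - Real.exp (-M)).toNNReal (truncatedGap M) := by
  have hL : 0 ≤ 1 - Real.exp (-M) := by
    linarith [Real.exp_le_one_iff.2 (show -M ≤ 0 by linarith)]
  have key : ∀ a b, b ≤ a →
      |truncatedGap M a - truncatedGap M b| ≤ (1 - Real.exp (-M)) * |a - b| := fun a b hab => by
    rw [abs_of_nonneg (sub_nonneg.2 (monotone_truncatedGap hM hab)),
      abs_of_nonneg (sub_nonneg.2 hab)]
    have hle : max (-M) (min b 0) ≤ max (-M) (min a 0) := by gcongr
    have hclamp : max (-M) (min a 0) - max (-M) (min b 0) ≤ a - b := by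
      rcases le_total a 0 with ha | ha <;> rcases le_total b 0 with hb | hb <;>
      rcases max_cases (-M) (min a 0) with h1 | h1 <;>
      rcases max_cases (-M) (min b 0) with h2 | h2 <;>
      simp_all <;> linarith
    refine le_trans ?_ (mul_le_mul_of_nonneg_left hclamp hL)
    simp only [truncatedGap]
    have hb : -M ≤ max (-M) (min b 0) := le_max_left _ _
    set x := max (-M) (min b 0)
    set y := max (-M) (min a 0)
    have h1 : Real.exp y = Real.exp x * Real.exp (y - x) := by rw [← Real.exp_add]; ring_nf
    have h2 := mul_le_mul_of_nonneg_left (Real.add_one_le_exp (y - x)) (Real.exp_pos x).le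
    have h3 := mul_le_mul_of_nonneg_right (Real.exp_le_exp.2 hb) (sub_nonneg.2 hle)
    linarith
  refine .of_dist_le_mul fun a b => ?_
  rw [Real.coe_toNNReal _ hL, Real.dist_eq, Real.dist_eq]
  rcases le_total b a with h | h
  · exact key a b h
  · rw [abs_sub_comm, abs_sub_comm a]
    exact key b a h

lemma exists_scalar_solution {m β : ℝ} (hm : 0 < m) (hβ : 0 < β) :
    ∃ v p : ℝ → ℝ, (∀ x, HasDerivAt v (p x) x) ∧
      (∀ x, HasDerivAt p (2 * β * (Real.exp (v x) - 1) + m ^ 2 / Real.cosh (m * x) ^ 2) x) ∧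
      Tendsto v atTop (nhds 0) ∧ Tendsto v atBot (nhds 0) := by
  obtain ⟨q, hq⟩ := exists_nat_ge (m ^ 2 / β)
  rw [div_le_iff₀ hβ] at hq
  set n : ℕ := q + 2 with hn
  have hn0 : (0 : ℝ) < n := by positivity
  have hqn : (q : ℝ) ≤ n := by rw [hn]; push_cast; linarith
  set a : ℝ := m / n with ha
  have ha0 : 0 < a := by positivity
  have hna : n * a = m := by rw [ha]; field_simp
  have hma : m * a ≤ β := by
    rw [ha, mul_div_assoc', div_le_iff₀ hn0]
    nlinarith
  set M : ℝ := n * Real.log 2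
  have hM : 0 ≤ M := by have := Real.log_pos one_lt_two; positivity
  have hlin : ∀ c x : ℝ, HasDerivAt (fun x => c * x) c x := fun c x => by
    simpa using (hasDerivAt_id x).const_mul c
  have hvl : ∀ x, HasDerivAt (fun x => barrier n (a * x))
      (m * (Real.tanh (m * x) - Real.tanh (a * x))) x := fun x => by
    refine ((hasDerivAt_barrier n (a * x)).comp x (hlin a x)).congr_deriv ?_
    rw [← mul_assoc, hna]
    linear_combination (Real.tanh (m * x) - Real.tanh (a * x)) * hna
  have hpl : ∀ x, HasDerivAt (fun x => m * (Real.tanh (m * x) - Real.tanh (a * x)))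
      (m ^ 2 / Real.cosh (m * x) ^ 2 - m * a / Real.cosh (a * x) ^ 2) x := fun x => by
    refine ((((hasDerivAt_tanh (m * x)).comp x (hlin m x)).sub
      ((hasDerivAt_tanh (a * x)).comp x (hlin a x))).const_mul m).congr_deriv ?_
    ring
  have hcts : Continuous fun x => m ^ 2 / Real.cosh (m * x) ^ 2 :=
    continuous_const.div (by fun_prop) fun x => by have := Real.cosh_pos (m * x); positivity
  let s : ℝ →ᵇ ℝ := .ofNormedAddCommGroup (fun x => m ^ 2 / Real.cosh (m * x) ^ 2) hcts (m ^ 2)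
    fun x => by
      rw [Real.norm_of_nonneg (by positivity)]
      exact div_le_self (by positivity) (one_le_pow₀ (Real.one_le_cosh _))
  let vl : ℝ →ᵇ ℝ := .ofNormedAddCommGroup (fun x => barrier n (a * x))
    (continuous_iff_continuousAt.2 fun x => (hvl x).continuousAt) M fun x =>
      abs_le.2 ⟨le_barrier n _, (barrier_nonpos q _).trans hM⟩
  let pl : ℝ →ᵇ ℝ := .ofNormedAddCommGroup (fun x => m * (Real.tanh (m * x) - Real.tanh (a * x)))
    (continuous_iff_continuousAt.2 fun x => (hpl x).continuousAt) (m * 2) fun x => by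
      rw [norm_mul, Real.norm_of_nonneg hm.le]
      have h1 := abs_lt.1 (Real.abs_tanh_lt_one (m * x))
      have h2 := abs_lt.1 (Real.abs_tanh_lt_one (a * x))
      gcongr
      exact abs_le.2 ⟨by linarith, by linarith⟩
  have hk : 0 < Real.sqrt (2 * β) := by positivity
  have hk2 : Real.sqrt (2 * β) ^ 2 = 2 * β := Real.sq_sqrt (by positivity)
  obtain ⟨v, p, hv, hp, hvv⟩ := exists_solution_between hk
    (L := (1 - Real.exp (-M)).toNNReal) (by
      rw [Real.toNNReal_lt_one]
      linarith [Real.exp_pos (-M)])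
    (monotone_truncatedGap hM) (lipschitzWith_truncatedGap hM) s vl pl 0 0 hvl hpl
    (fun x => by
      have h1 : truncatedGap M (vl x) = vl x - (Real.exp (vl x) - 1) :=
        truncatedGap_of_mem (le_barrier n _) (barrier_nonpos q _)
      have h2 : Real.exp (vl x) ≤ 1 - 1 / (2 * Real.cosh (a * x) ^ 2) := exp_barrier_le q (a * x)
      have hc := Real.cosh_pos (a * x)
      have h3 : m * a / Real.cosh (a * x) ^ 2 ≤ β / Real.cosh (a * x) ^ 2 := by gcongr
      have h4 : β / Real.cosh (a * x) ^ 2 = 2 * β * (1 / (2 * Real.cosh (a * x) ^ 2)) := by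
        field_simp
      have h5 : s x = m ^ 2 / Real.cosh (m * x) ^ 2 := rfl
      rw [hk2, h1, h5]
      nlinarith)
    (qu := 0) (fun x => hasDerivAt_const x _) (fun x => hasDerivAt_const x _) (fun x => by
      have h1 : truncatedGap M 0 = 0 := by simp [truncatedGap_of_mem (neg_nonpos.2 hM) le_rfl]
      have h2 : 0 ≤ s x := show 0 ≤ m ^ 2 / Real.cosh (m * x) ^ 2 by positivity
      simpa [h1] using h2)
  have hmul_top : Tendsto (fun x => a * x) atTop atTop := tendsto_id.const_mul_atTop ha0
  have hmul_bot : Tendsto (fun x => a * x) atBot atBot := tendsto_id.const_mul_atBot ha0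
  refine ⟨v, p, hv, fun x => ?_,
    tendsto_of_tendsto_of_tendsto_of_le_of_le
      ((tendsto_barrier_atTop (by omega)).comp hmul_top) tendsto_const_nhds
      (fun x => (hvv x).1) fun x => (hvv x).2,
    tendsto_of_tendsto_of_tendsto_of_le_of_le
      ((tendsto_barrier_atBot (by omega)).comp hmul_bot) tendsto_const_nhds
      (fun x => (hvv x).1) fun x => (hvv x).2⟩
  refine (hp x).congr_deriv ?_
  rw [hk2, truncatedGap_of_mem ((le_barrier n _).trans (hvv x).1) (hvv x).2, sub_sub_cancel]
  rfl

lemma tendsto_deriv_atTop {v p q : ℝ → ℝ} (hv : ∀ x, HasDerivAt v (p x) x)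
    (hp : ∀ x, HasDerivAt p (q x) x) (hv0 : Tendsto v atTop (nhds 0))
    (hq0 : Tendsto q atTop (nhds 0)) : Tendsto p atTop (nhds 0) := by
  rw [Metric.tendsto_atTop] at hv0 hq0 ⊢
  intro ε hε
  obtain ⟨N₁, h₁⟩ := hv0 (ε / 4) (by positivity)
  obtain ⟨N₂, h₂⟩ := hq0 (ε / 4) (by positivity)
  simp only [Real.dist_0_eq_abs] at h₁ h₂ ⊢
  refine ⟨max N₁ N₂, fun x hx => ?_⟩
  have hx₁ := (le_max_left _ _).trans hx
  have hx₂ := (le_max_right _ _).trans hx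
  obtain ⟨c, hc, hpc⟩ := exists_hasDerivAt_eq_slope v p (lt_add_one x)
    (fun y _ => (hv y).continuousAt.continuousWithinAt) fun y _ => hv y
  rw [add_sub_cancel_left, div_one] at hpc
  have hd : ‖p x - p c‖ ≤ ε / 4 * ‖x - c‖ :=
    (convex_Ici x).norm_image_sub_le_of_norm_hasDerivWithin_le
      (fun y _ => (hp y).hasDerivWithinAt) (fun y hy => (h₂ y (hx₂.trans hy)).le)
      hc.1.le Set.self_mem_Ici
  have hxc : ‖x - c‖ ≤ 1 := abs_le.2 ⟨by linarith [hc.2], by linarith [hc.1]⟩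
  have hd' : |p x - p c| ≤ ε / 4 := hd.trans (by nlinarith)
  have b₁ := abs_lt.1 (h₁ x hx₁)
  have b₂ := abs_lt.1 (h₁ (x + 1) (by linarith))
  have b₃ := abs_le.1 hd'
  exact abs_lt.2 ⟨by linarith, by linarith⟩

lemma tendsto_deriv_atBot {v p q : ℝ → ℝ} (hv : ∀ x, HasDerivAt v (p x) x)
    (hp : ∀ x, HasDerivAt p (q x) x) (hv0 : Tendsto v atBot (nhds 0))
    (hq0 : Tendsto q atBot (nhds 0)) : Tendsto p atBot (nhds 0) := by
  have h := tendsto_deriv_atTop (v := fun x => v (-x)) (p := fun x => -p (-x))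
    (q := fun x => q (-x)) (fun x => ((hv (-x)).comp x (hasDerivAt_neg x)).congr_deriv (by ring))
    (fun x => ((hp (-x)).comp x (hasDerivAt_neg x)).neg.congr_deriv (by ring))
    (hv0.comp tendsto_neg_atTop_atBot) (hq0.comp tendsto_neg_atTop_atBot)
  simpa [Function.comp_def] using (h.comp tendsto_neg_atBot_atTop).neg

lemma eq_zero_of_mul_deriv_deriv_nonneg {d p q : ℝ → ℝ} (hd : ∀ x, HasDerivAt d (p x) x)
    (hp : ∀ x, HasDerivAt p (q x) x) (hq : ∀ x, 0 ≤ d x * q x)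
    (hbot : Tendsto d atBot (nhds 0)) (htop : Tendsto d atTop (nhds 0)) (x : ℝ) : d x = 0 := by
  have hD : ∀ x, HasDerivAt (fun x => d x * d x) (2 * (d x * p x)) x := fun x =>
    ((hd x).mul (hd x)).congr_deriv (by ring)
  have hD' : ∀ x, HasDerivAt (fun x => 2 * (d x * p x)) (2 * (p x * p x + d x * q x)) x :=
    fun x => ((hd x).mul (hp x)).const_mul 2
  have hderiv : deriv (fun x => d x * d x) = fun x => 2 * (d x * p x) :=
    funext fun x => (hD x).deriv
  have hmono : Monotone (deriv fun x => d x * d x) := by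
    rw [hderiv]
    exact monotone_of_hasDerivAt_nonneg hD' fun x =>
      mul_nonneg zero_le_two (add_nonneg (mul_self_nonneg _) (hq x))
  obtain ⟨-, hconv⟩ := hmono.convexOn_univ_of_deriv fun x => (hD x).differentiableAt
  have hmid : ∀ t : ℝ, d x * d x ≤
      (2⁻¹ : ℝ) * (d (x + -t) * d (x + -t)) + (2⁻¹ : ℝ) * (d (x + t) * d (x + t)) := fun t => by
    have := hconv (Set.mem_univ (x + -t)) (Set.mem_univ (x + t)) (a := (2⁻¹ : ℝ)) (b := (2⁻¹ : ℝ))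
      (by norm_num) (by norm_num) (by norm_num)
    have hx : (2⁻¹ : ℝ) * (x + -t) + 2⁻¹ * (x + t) = x := by ring
    simpa only [smul_eq_mul, hx] using this
  have hl : Tendsto (fun t => d (x + -t)) atTop (nhds 0) :=
    hbot.comp (tendsto_atBot_add_const_left _ x tendsto_neg_atTop_atBot)
  have hr : Tendsto (fun t => d (x + t)) atTop (nhds 0) :=
    htop.comp (tendsto_atTop_add_const_left _ x tendsto_id)
  have hlim := ((hl.mul hl).const_mul (2⁻¹ : ℝ)).add ((hr.mul hr).const_mul (2⁻¹ : ℝ))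
  have hle := ge_of_tendsto' hlim hmid
  simp only [mul_zero, add_zero] at hle
  exact mul_self_eq_zero.1 (hle.antisymm (mul_self_nonneg _))

lemma pos_of_hasDerivAt_mul {F c : ℝ → ℝ} (hc : Continuous c)
    (hF : ∀ x, HasDerivAt F (c x * F x) x) {l : Filter ℝ} [l.NeBot] {L : ℝ} (hL : 0 < L)
    (hlim : Tendsto F l (nhds L)) (x : ℝ) : 0 < F x := by
  set C : ℝ → ℝ := fun x => ∫ y in (0 : ℝ)..x, c y
  have hC : ∀ x, HasDerivAt C (c x) x := fun x =>
    intervalIntegral.integral_hasDerivAt_right (hc.intervalIntegrable _ _)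
      hc.aestronglyMeasurable.stronglyMeasurableAtFilter hc.continuousAt
  have hG : ∀ x, HasDerivAt (fun x => F x * Real.exp (-C x)) 0 x := fun x =>
    ((hF x).mul (hC x).neg.exp).congr_deriv (by ring)
  have hconst := is_const_of_deriv_eq_zero (fun x => (hG x).differentiableAt)
    fun x => (hG x).deriv
  obtain ⟨y, hy⟩ := (hlim.eventually (lt_mem_nhds hL)).exists
  have : 0 < F x * Real.exp (-C x) := by
    have hxy : F x * Real.exp (-C x) = F y * Real.exp (-C y) := hconst x y
    rw [hxy]
    exact mul_pos hy (Real.exp_pos _)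
  exact pos_of_mul_pos_left this (Real.exp_pos _).le

/-- Solutions of the rescaled BPS system connecting `(-1, 0, 1)` to `(0, 1, 0)`. -/
structure IsDomainWall (m β : ℝ) (h f g : ℝ → ℝ) : Prop where
  hasDerivAt_h : ∀ x, HasDerivAt h (-(β / m) * (f x ^ 2 + g x ^ 2 - 1)) x
  hasDerivAt_f : ∀ x, HasDerivAt f (-(m * f x * h x)) x
  hasDerivAt_g : ∀ x, HasDerivAt g (-(m * (h x + 1) * g x)) x
  h_atBot : Tendsto h atBot (nhds (-1))
  f_atBot : Tendsto f atBot (nhds 0)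
  g_atBot : Tendsto g atBot (nhds 1)
  h_atTop : Tendsto h atTop (nhds 0)
  f_atTop : Tendsto f atTop (nhds 1)
  g_atTop : Tendsto g atTop (nhds 0)

namespace IsDomainWall

variable {m β : ℝ} {h f g h₂ f₂ g₂ : ℝ → ℝ}

lemma continuous_h (H : IsDomainWall m β h f g) : Continuous h :=
  continuous_iff_continuousAt.2 fun x => (H.hasDerivAt_h x).continuousAt

lemma continuous_f (H : IsDomainWall m β h f g) : Continuous f :=
  continuous_iff_continuousAt.2 fun x => (H.hasDerivAt_f x).continuousAt

lemma continuous_g (H : IsDomainWall m β h f g) : Continuous g :=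
  continuous_iff_continuousAt.2 fun x => (H.hasDerivAt_g x).continuousAt

lemma f_pos (H : IsDomainWall m β h f g) : ∀ x, 0 < f x :=
  pos_of_hasDerivAt_mul (c := fun x => -(m * h x)) (by have := H.continuous_h; fun_prop)
    (fun x => (H.hasDerivAt_f x).congr_deriv (by ring)) one_pos H.f_atTop

lemma g_pos (H : IsDomainWall m β h f g) : ∀ x, 0 < g x :=
  pos_of_hasDerivAt_mul (c := fun x => -(m * (h x + 1))) (by have := H.continuous_h; fun_prop)
    (fun x => (H.hasDerivAt_g x).congr_deriv (by ring)) one_pos H.g_atBot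

lemma exists_f_eq (hm : 0 < m) (H : IsDomainWall m β h f g) :
    ∃ c, ∀ x, f x = Real.exp (m * (x + c)) * g x := by
  have hR : ∀ x, HasDerivAt (fun x => f x / g x * Real.exp (-m * x)) 0 x := fun x => by
    have hg := (H.g_pos x).ne'
    have hexp := ((hasDerivAt_id x).const_mul (-m)).exp
    refine (((H.hasDerivAt_f x).div (H.hasDerivAt_g x) hg).mul hexp).congr_deriv ?_
    simp only [id, Pi.div_apply]
    field_simp
    ring
  have hconst := is_const_of_deriv_eq_zero (fun x => (hR x).differentiableAt)
    fun x => (hR x).deriv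
  have h0 : 0 < f 0 / g 0 := div_pos (H.f_pos 0) (H.g_pos 0)
  refine ⟨Real.log (f 0 / g 0) / m, fun x => ?_⟩
  have hx : f x / g x * Real.exp (-m * x) = f 0 / g 0 := by simpa using hconst x 0
  rw [mul_add, mul_div_cancel₀ _ hm.ne', Real.exp_add, Real.exp_log h0, ← hx]
  have hinv : Real.exp (m * x) * Real.exp (-m * x) = 1 := by rw [← Real.exp_add]; simp
  rw [neg_mul] at hinv ⊢
  have hg := H.g_pos x
  field_simp
  linear_combination (-f x) * hinv

lemma translate (H : IsDomainWall m β h f g) (c : ℝ) :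
    IsDomainWall m β (fun x => h (x + c)) (fun x => f (x + c)) fun x => g (x + c) where
  hasDerivAt_h x := (H.hasDerivAt_h (x + c)).comp_add_const x c
  hasDerivAt_f x := (H.hasDerivAt_f (x + c)).comp_add_const x c
  hasDerivAt_g x := (H.hasDerivAt_g (x + c)).comp_add_const x c
  h_atBot := H.h_atBot.comp (tendsto_atBot_add_const_right _ c tendsto_id)
  f_atBot := H.f_atBot.comp (tendsto_atBot_add_const_right _ c tendsto_id)
  g_atBot := H.g_atBot.comp (tendsto_atBot_add_const_right _ c tendsto_id)
  h_atTop := H.h_atTop.comp (tendsto_atTop_add_const_right _ c tendsto_id)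
  f_atTop := H.f_atTop.comp (tendsto_atTop_add_const_right _ c tendsto_id)
  g_atTop := H.g_atTop.comp (tendsto_atTop_add_const_right _ c tendsto_id)

lemma eq_of_ratio_eq (hm : 0 < m) (hβ : 0 < β) (H : IsDomainWall m β h f g)
    (H₂ : IsDomainWall m β h₂ f₂ g₂) (hratio : ∀ x, f x * g₂ x = f₂ x * g x) (x : ℝ) :
    h₂ x = h x ∧ f₂ x = f x ∧ g₂ x = g x := by
  have hlog : ∀ x, Real.log (f₂ x) - Real.log (f x) = Real.log (g₂ x) - Real.log (g x) :=
    fun x => by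
      have := congrArg Real.log (hratio x)
      rw [Real.log_mul (H.f_pos x).ne' (H₂.g_pos x).ne',
        Real.log_mul (H₂.f_pos x).ne' (H.g_pos x).ne'] at this
      linarith
  have hd : ∀ x, HasDerivAt (fun x => Real.log (f₂ x) - Real.log (f x)) (m * (h x - h₂ x)) x :=
    fun x => by
      have hf := (H.f_pos x).ne'
      have hf₂ := (H₂.f_pos x).ne'
      refine (((H₂.hasDerivAt_f x).log hf₂).sub ((H.hasDerivAt_f x).log hf)).congr_deriv ?_
      field_simp
      ring
  have hp : ∀ x, HasDerivAt (fun x => m * (h x - h₂ x))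
      (β * ((f₂ x ^ 2 - f x ^ 2) + (g₂ x ^ 2 - g x ^ 2))) x := fun x => by
    refine (((H.hasDerivAt_h x).sub (H₂.hasDerivAt_h x)).const_mul m).congr_deriv ?_
    field_simp
    ring
  have hsign : ∀ {a b : ℝ}, 0 < a → 0 < b →
      0 ≤ (Real.log b - Real.log a) * (b ^ 2 - a ^ 2) := fun {a b} ha hb => by
    rcases le_total a b with hab | hab
    · exact mul_nonneg (sub_nonneg.2 (Real.log_le_log ha hab))
        (sub_nonneg.2 (pow_le_pow_left₀ ha.le hab 2))
    · exact mul_nonneg_of_nonpos_of_nonpos (sub_nonpos.2 (Real.log_le_log hb hab))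
        (sub_nonpos.2 (pow_le_pow_left₀ hb.le hab 2))
  have hzero := eq_zero_of_mul_deriv_deriv_nonneg hd hp
    (fun x => by
      have h1 := hsign (H.f_pos x) (H₂.f_pos x)
      have h2 := hsign (H.g_pos x) (H₂.g_pos x)
      rw [← hlog x] at h2
      have := mul_nonneg hβ.le (add_nonneg h1 h2)
      linarith)
    (by
      simp only [hlog]
      simpa using (H₂.g_atBot.log one_ne_zero).sub (H.g_atBot.log one_ne_zero))
    (by simpa using (H₂.f_atTop.log one_ne_zero).sub (H.f_atTop.log one_ne_zero))
  refine ⟨?_, ?_, ?_⟩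
  · have h0 : HasDerivAt (fun x => Real.log (f₂ x) - Real.log (f x)) 0 x := by
      rw [funext hzero]
      exact hasDerivAt_const x 0
    have := (mul_eq_zero.1 ((hd x).unique h0)).resolve_left hm.ne'
    linarith
  · exact Real.log_injOn_pos (H₂.f_pos x) (H.f_pos x) (sub_eq_zero.1 (hzero x))
  · exact Real.log_injOn_pos (H₂.g_pos x) (H.g_pos x)
      (sub_eq_zero.1 ((hlog x).symm.trans (hzero x)))

lemma eq_translate (hm : 0 < m) (hβ : 0 < β) (H : IsDomainWall m β h f g)
    (H₂ : IsDomainWall m β h₂ f₂ g₂) :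
    ∃ c, ∀ x, h₂ x = h (x + c) ∧ f₂ x = f (x + c) ∧ g₂ x = g (x + c) := by
  obtain ⟨c₁, h₁⟩ := H.exists_f_eq hm
  obtain ⟨c₂, h₂⟩ := H₂.exists_f_eq hm
  refine ⟨c₂ - c₁, (H.translate (c₂ - c₁)).eq_of_ratio_eq hm hβ H₂ fun x => ?_⟩
  rw [h₁, h₂, show x + (c₂ - c₁) + c₁ = x + c₂ by ring]
  ring

end IsDomainWall

lemma exists_isDomainWall {m β : ℝ} (hm : 0 < m) (hβ : 0 < β) :
    ∃ h f g : ℝ → ℝ, IsDomainWall m β h f g := by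
  obtain ⟨v, p, hv, hp, hv_top, hv_bot⟩ := exists_scalar_solution hm hβ
  have hmul_top : Tendsto (fun x => m * x) atTop atTop := tendsto_id.const_mul_atTop hm
  have hmul_bot : Tendsto (fun x => m * x) atBot atBot := tendsto_id.const_mul_atBot hm
  have hs_top : Tendsto (fun x => m ^ 2 / Real.cosh (m * x) ^ 2) atTop (nhds 0) := by
    have := ((tendsto_inv_cosh.comp hmul_top).pow 2).const_mul (m ^ 2)
    simpa [Function.comp_def, div_eq_mul_inv] using this
  have hs_bot : Tendsto (fun x => m ^ 2 / Real.cosh (m * x) ^ 2) atBot (nhds 0) := by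
    simpa [Function.comp_def] using hs_top.comp tendsto_neg_atBot_atTop
  have hp_top : Tendsto p atTop (nhds 0) := tendsto_deriv_atTop hv hp hv_top (by
    simpa using ((((Real.continuous_exp.tendsto 0).comp hv_top).sub_const 1).const_mul
      (2 * β)).add hs_top)
  have hp_bot : Tendsto p atBot (nhds 0) := tendsto_deriv_atBot hv hp hv_bot (by
    simpa using ((((Real.continuous_exp.tendsto 0).comp hv_bot).sub_const 1).const_mul
      (2 * β)).add hs_bot)
  have hlin : ∀ x : ℝ, HasDerivAt (fun x => m * x) m x := fun x => by
    simpa using (hasDerivAt_id x).const_mul m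
  have hL : ∀ x, HasDerivAt (fun x => logTwoCosh (m * x)) (Real.tanh (m * x) * m) x := fun x =>
    (hasDerivAt_logTwoCosh (m * x)).comp x (hlin x)
  have htanh : ∀ x, HasDerivAt (fun x => Real.tanh (m * x)) (1 / Real.cosh (m * x) ^ 2 * m) x :=
    fun x => (hasDerivAt_tanh (m * x)).comp x (hlin x)
  set f : ℝ → ℝ := fun x => Real.exp ((v x - (logTwoCosh (m * x) - m * x)) / 2) with hf
  set g : ℝ → ℝ := fun x => Real.exp ((v x - (logTwoCosh (m * x) + m * x)) / 2) with hg
  have hfg : ∀ x, f x = g x * Real.exp (m * x) := fun x => by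
    simp only [hf, hg, ← Real.exp_add]
    ring_nf
  have hgf : ∀ x, g x = f x * Real.exp (-(m * x)) := fun x => by
    simp only [hf, hg, ← Real.exp_add]
    ring_nf
  have hsum : ∀ x, f x ^ 2 + g x ^ 2 = Real.exp (v x) := fun x => by
    have h1 : f x ^ 2 = Real.exp (v x) / Real.exp (logTwoCosh (m * x)) * Real.exp (m * x) := by
      simp only [hf, ← Real.exp_nat_mul, ← Real.exp_sub, ← Real.exp_add]
      push_cast
      ring_nf
    have h2 : g x ^ 2 = Real.exp (v x) / Real.exp (logTwoCosh (m * x)) * Real.exp (-(m * x)) := by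
      simp only [hg, ← Real.exp_nat_mul, ← Real.exp_sub, ← Real.exp_add]
      push_cast
      ring_nf
    rw [h1, h2, ← mul_add, ← exp_logTwoCosh, div_mul_cancel₀ _ (Real.exp_pos _).ne']
  have hlog_top := tendsto_logTwoCosh_sub_self.comp hmul_top
  have hlog_bot := tendsto_logTwoCosh_sub_self.comp (tendsto_neg_atBot_atTop.comp hmul_bot)
  have hf_top : Tendsto f atTop (nhds 1) := by
    have := (Real.continuous_exp.tendsto _).comp ((hv_top.sub hlog_top).div_const 2)
    simpa [Function.comp_def] using this
  have hg_bot : Tendsto g atBot (nhds 1) := by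
    have := (Real.continuous_exp.tendsto _).comp ((hv_bot.sub hlog_bot).div_const 2)
    simpa [Function.comp_def, logTwoCosh_neg] using this
  refine ⟨fun x => (Real.tanh (m * x) - 1) / 2 - p x / (2 * m), f, g, ?_, ?_, ?_, ?_, ?_, hg_bot,
    ?_, hf_top, ?_⟩
  · intro x
    refine ((((htanh x).sub_const 1).div_const 2).sub ((hp x).div_const (2 * m))).congr_deriv ?_
    rw [hsum]
    field_simp
    ring
  · intro x
    refine ((((hv x).sub ((hL x).sub (hlin x))).div_const 2).exp).congr_deriv ?_
    simp only [hf, Pi.sub_apply]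
    field_simp
    ring
  · intro x
    refine ((((hv x).sub ((hL x).add (hlin x))).div_const 2).exp).congr_deriv ?_
    simp only [hg, Pi.sub_apply, Pi.add_apply]
    field_simp
    ring
  · have := (((tendsto_tanh_atBot.comp hmul_bot).sub_const 1).div_const 2).sub
      (hp_bot.div_const (2 * m))
    norm_num at this
    exact this
  · have := hg_bot.mul (Real.tendsto_exp_atBot.comp hmul_bot)
    rw [mul_zero] at this
    exact this.congr fun x => (hfg x).symm
  · have := (((tendsto_tanh_atTop.comp hmul_top).sub_const 1).div_const 2).sub
      (hp_top.div_const (2 * m))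
    norm_num at this
    exact this
  · have := hf_top.mul (Real.tendsto_exp_neg_atTop_nhds_zero.comp hmul_top)
    rw [mul_zero] at this
    exact this.congr fun x => (hgf x).symm

/-- The rescaled Burinskii–Morris BPS system
`m h' = -β(f² − 1) − βg²`, `f' = -mfh`, `g' = -m(h+1)g` with boundary conditions
`(h,f,g)(-∞) = (-1, 0, 1)` and `(h,f,g)(+∞) = (0, 1, 0)` has a solution, unique up to
translations of the independent variable. -/
theorem rescaled_bps_existence_uniqueness (m β : ℝ) (hm : 0 < m) (hβ : 0 < β) :
    ∃ h f g : ℝ → ℝ, ContDiff ℝ 1 h ∧ ContDiff ℝ 1 f ∧ ContDiff ℝ 1 g ∧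
      (∀ x : ℝ, m * deriv h x = -(β * ((f x) ^ 2 - 1)) - β * (g x) ^ 2) ∧
      (∀ x : ℝ, deriv f x = -(m * f x * h x)) ∧
      (∀ x : ℝ, deriv g x = -(m * (h x + 1) * g x)) ∧
      Tendsto h atBot (nhds (-1)) ∧ Tendsto f atBot (nhds 0) ∧ Tendsto g atBot (nhds 1) ∧
      Tendsto h atTop (nhds 0) ∧ Tendsto f atTop (nhds 1) ∧ Tendsto g atTop (nhds 0) ∧
      (∀ h₂ f₂ g₂ : ℝ → ℝ, ContDiff ℝ 1 h₂ → ContDiff ℝ 1 f₂ → ContDiff ℝ 1 g₂ →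
        (∀ x : ℝ, m * deriv h₂ x = -(β * ((f₂ x) ^ 2 - 1)) - β * (g₂ x) ^ 2) →
        (∀ x : ℝ, deriv f₂ x = -(m * f₂ x * h₂ x)) →
        (∀ x : ℝ, deriv g₂ x = -(m * (h₂ x + 1) * g₂ x)) →
        Tendsto h₂ atBot (nhds (-1)) → Tendsto f₂ atBot (nhds 0) →
        Tendsto g₂ atBot (nhds 1) → Tendsto h₂ atTop (nhds 0) →
        Tendsto f₂ atTop (nhds 1) → Tendsto g₂ atTop (nhds 0) →
        ∃ c : ℝ, ∀ x : ℝ, h₂ x = h (x + c) ∧ f₂ x = f (x + c) ∧ g₂ x = g (x + c)) := by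
  obtain ⟨h, f, g, H⟩ := exists_isDomainWall hm hβ
  have hc := H.continuous_h
  have fc := H.continuous_f
  have gc := H.continuous_g
  have hh : deriv h = fun x => -(β / m) * (f x ^ 2 + g x ^ 2 - 1) :=
    funext fun x => (H.hasDerivAt_h x).deriv
  have hf : deriv f = fun x => -(m * f x * h x) := funext fun x => (H.hasDerivAt_f x).deriv
  have hg : deriv g = fun x => -(m * (h x + 1) * g x) := funext fun x => (H.hasDerivAt_g x).deriv
  refine ⟨h, f, g,
    contDiff_one_iff_deriv.2 ⟨fun x => (H.hasDerivAt_h x).differentiableAt, hh ▸ by fun_prop⟩,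
    contDiff_one_iff_deriv.2 ⟨fun x => (H.hasDerivAt_f x).differentiableAt, hf ▸ by fun_prop⟩,
    contDiff_one_iff_deriv.2 ⟨fun x => (H.hasDerivAt_g x).differentiableAt, hg ▸ by fun_prop⟩,
    fun x => ?_, congrFun hf, congrFun hg, H.h_atBot, H.f_atBot, H.g_atBot,
    H.h_atTop, H.f_atTop, H.g_atTop, ?_⟩
  · rw [hh]
    field_simp
    ring
  · intro h₂ f₂ g₂ ch cf cg dh df dg bh bf bg th tf tg
    refine H.eq_translate hm hβ ⟨fun x => ?_, fun x => ?_, fun x => ?_, bh, bf, bg, th, tf, tg⟩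
    · refine ((ch.differentiable one_ne_zero) x).hasDerivAt.congr_deriv ?_
      rw [eq_comm, ← mul_right_inj' hm.ne', dh x]
      field_simp
      ring
    · exact df x ▸ ((cf.differentiable one_ne_zero) x).hasDerivAt
    · exact dg x ▸ ((cg.differentiable one_ne_zero) x).hasDerivAt
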